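/- arXiv:2211.04015 — 3 statements merged into one kernel-verified Lean document; each statement's English description precedes it below -/
import Mathlib

section
/- Suppose the algebra C(a,b,c,d;ε,δ) is curled. Then C(a,b,c,d;ε,δ) is unital if and only if (a,b,c,d,ε,δ) is one of (0,0,0,0,1,1), (0,1,0,1,1,1), (1,0,1,0,1,1), i.e., the algebra equals one of C(0,0,0,0;1,1), C(0,1,0,1;1,1), C(1,0,1,0;1,1). -/
/-- The field with two elements. -/
abbrev F2 : Type := ZMod 2

/-- The two-dimensional `F2`-vector space. -/
abbrev V : Type := F2 × F2

/-- A two-dimensional algebra over `F2`: an `F2`-bilinear multiplication on `V`. -/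
abbrev Mul2 : Type := V →ₗ[F2] V →ₗ[F2] V

/-- The two-dimensional algebra over `F2` whose structure matrix (w.r.t. the standard
basis `e = (1,0)`, `f = (0,1)`) is `M`; the rows of `M` give `e²`, `f²`, `e·f`, `f·e`. -/
def mulOf (M : Matrix (Fin 4) (Fin 2) F2) : Mul2 :=
  LinearMap.mk₂ F2
    (fun x y =>
      (x.1 * y.1 * M 0 0 + x.2 * y.2 * M 1 0 + x.1 * y.2 * M 2 0 + x.2 * y.1 * M 3 0,
       x.1 * y.1 * M 0 1 + x.2 * y.2 * M 1 1 + x.1 * y.2 * M 2 1 + x.2 * y.1 * M 3 1))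
    (by intro m n p; simp [Prod.ext_iff]; constructor <;> ring)
    (by intro c m p; simp [Prod.ext_iff, smul_eq_mul]; constructor <;> ring)
    (by intro m n p; simp [Prod.ext_iff]; constructor <;> ring)
    (by intro c m p; simp [Prod.ext_iff, smul_eq_mul]; constructor <;> ring)

/-- The first standard basis vector. -/
def e : V := (1, 0)

/-- The second standard basis vector. -/
def f : V := (0, 1)

/-- The structure matrix of a two-dimensional algebra over `F2` w.r.t. the standard basis:
its rows are the coordinates of `e²`, `f²`, `e·f`, `f·e`. -/
def structMatrix (μ : Mul2) : Matrix (Fin 4) (Fin 2) F2 :=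
  ![![(μ e e).1, (μ e e).2],
    ![(μ f f).1, (μ f f).2],
    ![(μ e f).1, (μ e f).2],
    ![(μ f e).1, (μ f e).2]]

/-- Two two-dimensional algebras over `F2` are isomorphic: there is an `F2`-linear
bijection preserving multiplication. -/
def IsIso (μ μ' : Mul2) : Prop :=
  ∃ φ : V ≃ₗ[F2] V, ∀ x y : V, φ (μ x y) = μ' (φ x) (φ y)

/-- An algebra is endo-commutative if `(x·x)·(y·y) = (x·y)·(x·y)` for all `x, y`. -/
def EndoCommutative (μ : Mul2) : Prop :=
  ∀ x y : V, μ (μ x x) (μ y y) = μ (μ x y) (μ x y)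

/-- An algebra is curled if every square `x·x` is a scalar multiple of `x`. -/
def Curled (μ : Mul2) : Prop := ∀ x : V, ∃ lam : F2, μ x x = lam • x

/-- An algebra is commutative if `x·y = y·x` for all `x, y`. -/
def IsCommutative2 (μ : Mul2) : Prop := ∀ x y : V, μ x y = μ y x

/-- An algebra is associative if `(x·y)·z = x·(y·z)` for all `x, y, z`. -/
def IsAssociative2 (μ : Mul2) : Prop := ∀ x y z : V, μ (μ x y) z = μ x (μ y z)

/-- An algebra is unital if it has a two-sided unit. -/
def IsUnital2 (μ : Mul2) : Prop := ∃ u : V, ∀ x : V, μ u x = x ∧ μ x u = x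

/-- An algebra is zeropotent if `x·x = 0` for all `x`. -/
def Zeropotent (μ : Mul2) : Prop := ∀ x : V, μ x x = 0

/-- For `X = [[a,b],[c,d]]`, `tilde X` is the 4×4 matrix with rows
`(a,b,ab,ab)`, `(c,d,cd,cd)`, `(ac,bd,ad,bc)`, `(ac,bd,bc,ad)`. -/
def tilde (X : Matrix (Fin 2) (Fin 2) F2) : Matrix (Fin 4) (Fin 4) F2 :=
  ![![X 0 0, X 0 1, X 0 0 * X 0 1, X 0 0 * X 0 1],
    ![X 1 0, X 1 1, X 1 0 * X 1 1, X 1 0 * X 1 1],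
    ![X 0 0 * X 1 0, X 0 1 * X 1 1, X 0 0 * X 1 1, X 0 1 * X 1 0],
    ![X 0 0 * X 1 0, X 0 1 * X 1 1, X 0 1 * X 1 0, X 0 0 * X 1 1]]

/-- The curled-type algebra `C(a,b,c,d;ε,δ)`:
`e² = ε·e`, `f² = δ·f`, `e·f = a·e + b·f`, `f·e = c·e + d·f`. -/
def Calg (a b c d ε δ : F2) : Mul2 := mulOf ![![ε, 0], ![0, δ], ![a, b], ![c, d]]

/-- The straight-type algebra `S(p,q,a,b,c,d)`:
`e² = f`, `f² = p·e + q·f`, `e·f = a·e + b·f`, `f·e = c·e + d·f`. -/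
def Salg (p q a b c d : F2) : Mul2 := mulOf ![![0, 1], ![p, q], ![a, b], ![c, d]]

theorem Calg_apply (a b c d ε δ : F2) (x y : V) :
    Calg a b c d ε δ x y =
      (x.1 * y.1 * ε + x.1 * y.2 * a + x.2 * y.1 * c,
       x.2 * y.2 * δ + x.1 * y.2 * b + x.2 * y.1 * d) := by
  simp [Calg, mulOf]

set_option synthInstance.maxSize 10000 in
/-- A curled `C(a,b,c,d;ε,δ)` is unital iff `(a,b,c,d,ε,δ)` is one of
`(0,0,0,0,1,1)`, `(0,1,0,1,1,1)`, `(1,0,1,0,1,1)`. -/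
theorem Calg_unital_iff (a b c d ε δ : F2) (h : Curled (Calg a b c d ε δ)) :
    IsUnital2 (Calg a b c d ε δ) ↔
      (((a, b, c, d, ε, δ) : F2 × F2 × F2 × F2 × F2 × F2) = (0, 0, 0, 0, 1, 1) ∨
       ((a, b, c, d, ε, δ) : F2 × F2 × F2 × F2 × F2 × F2) = (0, 1, 0, 1, 1, 1) ∨
       ((a, b, c, d, ε, δ) : F2 × F2 × F2 × F2 × F2 × F2) = (1, 0, 1, 0, 1, 1)) := by
  simp only [Curled, IsUnital2, Calg_apply, Prod.forall, Prod.exists, Prod.smul_mk, smul_eq_mul,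
    Prod.mk.injEq] at h ⊢
  revert a b c d ε δ
  decide
end

section
/- Let A be a two-dimensional curled algebra over F₂, and let ECC²₀,…,ECC²₇ be the eight algebras given on a basis {e,f} by: ECC²₀: e²=f²=ef=fe=0; ECC²₁: e²=f²=0, ef=fe=f; ECC²₂: e²=f²=0, ef=f, fe=e; ECC²₃: e²=f²=0, ef=e, fe=f; ECC²₄: e²=e, f²=0, ef=f, fe=0; ECC²₅: e²=e, f²=0, ef=0, fe=f; ECC²₆: e²=e, f²=f, ef=fe=0; ECC²₇: e²=e, f²=f, ef=fe=e+f. Then: (i) A is zeropotent iff A is isomorphic to ECC²₀ or ECC²₁; (ii) A is unital iff A is isomorphic to ECC²₆; (iii) A is commutative iff A is isomorphic to one of ECC²₀, ECC²₁, ECC²₆, ECC²₇; (iv) A is associative iff A is isomorphic to one of ECC²₀, ECC²₄, ECC²₅, ECC²₆. -/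
/-- The eight representative endo-commutative curled algebras `ECC²₀, …, ECC²₇`;
rows of each structure matrix give `e²`, `f²`, `e·f`, `f·e`. -/
def ECC : Fin 8 → Mul2 :=
  ![mulOf ![![0, 0], ![0, 0], ![0, 0], ![0, 0]],
    mulOf ![![0, 0], ![0, 0], ![0, 1], ![0, 1]],
    mulOf ![![0, 0], ![0, 0], ![0, 1], ![1, 0]],
    mulOf ![![0, 0], ![0, 0], ![1, 0], ![0, 1]],
    mulOf ![![1, 0], ![0, 0], ![0, 1], ![0, 0]],
    mulOf ![![1, 0], ![0, 0], ![0, 0], ![0, 1]],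
    mulOf ![![1, 0], ![0, 1], ![0, 0], ![0, 0]],
    mulOf ![![1, 0], ![0, 1], ![1, 1], ![1, 1]]]

theorem Mul2.ext_basis {μ ν : Mul2} (hee : μ e e = ν e e) (hff : μ f f = ν f f)
    (hef : μ e f = ν e f) (hfe : μ f e = ν f e) : μ = ν := by
  have key : ∀ x : V, x = x.1 • e + x.2 • f := by
    intro x
    simp [e, f]
  refine LinearMap.ext₂ fun x y => ?_
  rw [key x, key y]
  simp only [map_add, map_smul, LinearMap.add_apply, LinearMap.smul_apply, hee, hff, hef, hfe]

theorem Curled.exists_eq_Calg {μ : Mul2} (hμ : Curled μ) :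
    ∃ a b c d ε δ : F2, μ = Calg a b c d ε δ := by
  obtain ⟨ε, hε⟩ := hμ e
  obtain ⟨δ, hδ⟩ := hμ f
  refine ⟨(μ e f).1, (μ e f).2, (μ f e).1, (μ f e).2, ε, δ, ?_⟩
  apply Mul2.ext_basis
  · rw [hε]; simp [Calg, mulOf, e]
  · rw [hδ]; simp [Calg, mulOf, f]
  · simp [Calg, mulOf, e, f]
  · simp [Calg, mulOf, e, f]

namespace IsIso

variable {μ ν : Mul2}

theorem zeropotent (h : IsIso μ ν) (hν : Zeropotent ν) : Zeropotent μ := by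
  obtain ⟨φ, hφ⟩ := h
  intro x
  apply φ.injective
  rw [hφ, hν, map_zero]

theorem isCommutative2 (h : IsIso μ ν) (hν : IsCommutative2 ν) : IsCommutative2 μ := by
  obtain ⟨φ, hφ⟩ := h
  intro x y
  apply φ.injective
  rw [hφ, hφ, hν]

theorem isAssociative2 (h : IsIso μ ν) (hν : IsAssociative2 ν) : IsAssociative2 μ := by
  obtain ⟨φ, hφ⟩ := h
  intro x y z
  apply φ.injective
  simp only [hφ]
  exact hν _ _ _

theorem isUnital2 (h : IsIso μ ν) (hν : IsUnital2 ν) : IsUnital2 μ := by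
  obtain ⟨φ, hφ⟩ := h
  obtain ⟨u, hu⟩ := hν
  refine ⟨φ.symm u, fun x => ⟨φ.injective ?_, φ.injective ?_⟩⟩
  · rw [hφ, φ.apply_symm_apply, (hu _).1]
  · rw [hφ, φ.apply_symm_apply, (hu _).2]

end IsIso

/-- The images `u`, `v` of `e`, `f` determine an injective linear map preserving
multiplication. -/
def HasBasisIso (μ ν : Mul2) : Prop :=
  ∃ u v : V, u.1 * v.2 - u.2 * v.1 = 1 ∧
    (μ e e).1 • u + (μ e e).2 • v = ν u u ∧ (μ f f).1 • u + (μ f f).2 • v = ν v v ∧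
    (μ e f).1 • u + (μ e f).2 • v = ν u v ∧ (μ f e).1 • u + (μ f e).2 • v = ν v u

theorem HasBasisIso.isIso {μ ν : Mul2} (h : HasBasisIso μ ν) : IsIso μ ν := by
  obtain ⟨u, v, hdet, hee, hff, hef, hfe⟩ := h
  let φ : V →ₗ[F2] V :=
    (LinearMap.fst F2 F2 F2).smulRight u + (LinearMap.snd F2 F2 F2).smulRight v
  have hφ : ∀ x, φ x = x.1 • u + x.2 • v := fun x => rfl
  have he : φ e = u := by simp [hφ, e]
  have hf : φ f = v := by simp [hφ, f]
  have hmul : μ.compr₂ φ = ν.compl₁₂ φ φ := by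
    apply Mul2.ext_basis <;>
      simp only [LinearMap.compr₂_apply, LinearMap.compl₁₂_apply, he, hf] <;> rw [hφ]
    exacts [hee, hff, hef, hfe]
  have hinj : Function.Injective φ := by
    rw [injective_iff_map_eq_zero]
    intro x hx
    rw [hφ, Prod.ext_iff] at hx
    simp only [Prod.fst_add, Prod.smul_fst, Prod.snd_add, Prod.smul_snd, smul_eq_mul,
      Prod.fst_zero, Prod.snd_zero] at hx
    obtain ⟨h1, h2⟩ := hx
    ext
    · simp only [Prod.fst_zero]
      linear_combination v.2 * h1 - v.1 * h2 - x.1 * hdet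
    · simp only [Prod.snd_zero]
      linear_combination u.1 * h2 - u.2 * h1 - x.2 * hdet
  refine ⟨LinearEquiv.ofBijective φ (Finite.injective_iff_bijective.mp hinj), fun x y => ?_⟩
  exact LinearMap.congr_fun₂ hmul x y

instance (μ : Mul2) : Decidable (Curled μ) := by unfold Curled; infer_instance

instance (μ : Mul2) : Decidable (Zeropotent μ) := by unfold Zeropotent; infer_instance

instance (μ : Mul2) : Decidable (IsCommutative2 μ) := by unfold IsCommutative2; infer_instance

instance (μ : Mul2) : Decidable (IsAssociative2 μ) := by unfold IsAssociative2; infer_instance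

instance (μ : Mul2) : Decidable (IsUnital2 μ) := by unfold IsUnital2; infer_instance

instance (μ ν : Mul2) : Decidable (HasBasisIso μ ν) := by unfold HasBasisIso; infer_instance

theorem Calg_hasBasisIso_of_zeropotent : ∀ a b c d ε δ : F2, Zeropotent (Calg a b c d ε δ) →
    HasBasisIso (Calg a b c d ε δ) (ECC 0) ∨ HasBasisIso (Calg a b c d ε δ) (ECC 1) := by
  decide +kernel

theorem Calg_hasBasisIso_of_isUnital2 : ∀ a b c d ε δ : F2, Curled (Calg a b c d ε δ) →
    IsUnital2 (Calg a b c d ε δ) → HasBasisIso (Calg a b c d ε δ) (ECC 6) := by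
  decide +kernel

theorem Calg_hasBasisIso_of_isCommutative2 : ∀ a b c d ε δ : F2, Curled (Calg a b c d ε δ) →
    IsCommutative2 (Calg a b c d ε δ) →
      HasBasisIso (Calg a b c d ε δ) (ECC 0) ∨ HasBasisIso (Calg a b c d ε δ) (ECC 1) ∨
      HasBasisIso (Calg a b c d ε δ) (ECC 6) ∨ HasBasisIso (Calg a b c d ε δ) (ECC 7) := by
  decide +kernel

theorem Calg_hasBasisIso_of_isAssociative2 : ∀ a b c d ε δ : F2, Curled (Calg a b c d ε δ) →
    IsAssociative2 (Calg a b c d ε δ) →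
      HasBasisIso (Calg a b c d ε δ) (ECC 0) ∨ HasBasisIso (Calg a b c d ε δ) (ECC 4) ∨
      HasBasisIso (Calg a b c d ε δ) (ECC 5) ∨ HasBasisIso (Calg a b c d ε δ) (ECC 6) := by
  decide +kernel

/-- For a two-dimensional curled algebra `A` over `F₂`:
(i) `A` is zeropotent iff it is isomorphic to `ECC²₀` or `ECC²₁`;
(ii) `A` is unital iff it is isomorphic to `ECC²₆`;
(iii) `A` is commutative iff it is isomorphic to one of `ECC²₀, ECC²₁, ECC²₆, ECC²₇`;
(iv) `A` is associative iff it is isomorphic to one of `ECC²₀, ECC²₄, ECC²₅, ECC²₆`. -/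
theorem curled_special_classification (μ : Mul2) (hc : Curled μ) :
    (Zeropotent μ ↔ (IsIso μ (ECC 0) ∨ IsIso μ (ECC 1))) ∧
    (IsUnital2 μ ↔ IsIso μ (ECC 6)) ∧
    (IsCommutative2 μ ↔
      (IsIso μ (ECC 0) ∨ IsIso μ (ECC 1) ∨ IsIso μ (ECC 6) ∨ IsIso μ (ECC 7))) ∧
    (IsAssociative2 μ ↔
      (IsIso μ (ECC 0) ∨ IsIso μ (ECC 4) ∨ IsIso μ (ECC 5) ∨ IsIso μ (ECC 6))) := by
  obtain ⟨a, b, c, d, ε, δ, rfl⟩ := hc.exists_eq_Calg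
  refine ⟨⟨fun h => ?_, ?_⟩, ⟨fun h => ?_, fun h => ?_⟩, ⟨fun h => ?_, ?_⟩, ⟨fun h => ?_, ?_⟩⟩
  · exact (Calg_hasBasisIso_of_zeropotent _ _ _ _ _ _ h).imp
      HasBasisIso.isIso HasBasisIso.isIso
  · rintro (h | h) <;> exact h.zeropotent (by decide +kernel)
  · exact (Calg_hasBasisIso_of_isUnital2 _ _ _ _ _ _ hc h).isIso
  · exact h.isUnital2 (by decide +kernel)
  · exact (Calg_hasBasisIso_of_isCommutative2 _ _ _ _ _ _ hc h).imp HasBasisIso.isIso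
      (Or.imp HasBasisIso.isIso (Or.imp HasBasisIso.isIso HasBasisIso.isIso))
  · rintro (h | h | h | h) <;> exact h.isCommutative2 (by decide +kernel)
  · exact (Calg_hasBasisIso_of_isAssociative2 _ _ _ _ _ _ hc h).imp HasBasisIso.isIso
      (Or.imp HasBasisIso.isIso (Or.imp HasBasisIso.isIso HasBasisIso.isIso))
  · rintro (h | h | h | h) <;> exact h.isAssociative2 (by decide +kernel)
end

section
/- For p,q,a,b,c,d ∈ F₂, the algebra S(p,q,a,b,c,d) is unital if and only if (p,q,a,b,c,d) is one of the two tuples (1,0,1,1,1,1) and (0,1,1,0,1,0). -/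
theorem Salg_apply (p q a b c d : F2) (x y : V) :
    Salg p q a b c d x y =
      (x.2 * y.2 * p + x.1 * y.2 * a + x.2 * y.1 * c,
       x.1 * y.1 + x.2 * y.2 * q + x.1 * y.2 * b + x.2 * y.1 * d) := by
  simp [Salg, mulOf]

set_option synthInstance.maxSize 2000 in
/-- `S(p,q,a,b,c,d)` is unital iff `(p,q,a,b,c,d)` is `(1,0,1,1,1,1)` or `(0,1,1,0,1,0)`. -/
theorem Salg_unital_iff (p q a b c d : F2) :
    IsUnital2 (Salg p q a b c d) ↔
      (((p, q, a, b, c, d) : F2 × F2 × F2 × F2 × F2 × F2) = (1, 0, 1, 1, 1, 1) ∨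
       ((p, q, a, b, c, d) : F2 × F2 × F2 × F2 × F2 × F2) = (0, 1, 1, 0, 1, 0)) := by
  simp only [IsUnital2, Salg_apply, Prod.exists, Prod.forall, Prod.mk.injEq]
  revert p q a b c d
  decide +kernel
end
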